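/- Let (H, n₁, σ₊, r₂, ρ) be a solution of the LRS Bianchi II (Nil) topo-GR system on an interval containing [t₀,∞), with Λ > 0, 1 + 3w ≥ 0, ρ(t) ≥ 0 for all t ≥ t₀, and H(t₀) > 0. Then H(t) ≥ √(Λ/3) for all t ≥ t₀, and as t → ∞: H(t) → √(Λ/3), σ₊(t) → 0, ρ(t) → 0, and n₁(t)·(r₂(t) − 1) → 0; i.e. a positive cosmological constant isotropizes LRS Bianchi II solutions of topo-GR and drives the spatial Ricci curvature towards the reference Ricci curvature. -/

import Mathlib

open Real Filter

/-- A differentiable function with `f' ≤ -c f` on `[a, ∞)` decays at least like `exp (-c t)`. -/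
theorem le_mul_exp_of_hasDerivAt_le {f f' : ℝ → ℝ} {a c : ℝ}
    (hf : ∀ t ≥ a, HasDerivAt f (f' t) t) (hle : ∀ t ≥ a, f' t ≤ -c * f t) :
    ∀ t ≥ a, f t ≤ f a * exp (-(c * (t - a))) := by
  have hg : ∀ t ≥ a, HasDerivAt (fun s => f s * exp (c * (s - a)))
      (f' t * exp (c * (t - a)) + f t * (exp (c * (t - a)) * (c * 1))) t := fun t ht =>
    (hf t ht).mul ((((hasDerivAt_id t).sub_const a).const_mul c).exp)
  have hanti : AntitoneOn (fun s => f s * exp (c * (s - a))) (Set.Ici a) := by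
    refine antitoneOn_of_deriv_nonpos (convex_Ici a)
      (fun t ht => (hg t ht).continuousAt.continuousWithinAt)
      (fun t ht => (hg t (interior_subset ht)).differentiableAt.differentiableWithinAt)
      (fun t ht => ?_)
    have ht' : t ≥ a := interior_subset ht
    rw [(hg t ht').deriv]
    nlinarith [hle t ht', exp_pos (c * (t - a))]
  intro t ht
  have h := hanti Set.self_mem_Ici ht ht
  simp only [sub_self, mul_zero, exp_zero, mul_one] at h
  rwa [exp_neg, ← div_eq_mul_inv, le_div_iff₀ (exp_pos _)]

/-- A nonvanishing continuous function on `[a, ∞)` that is positive at `a` stays positive. -/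
theorem pos_of_continuousOn_of_ne_zero {f : ℝ → ℝ} {a : ℝ} (hf : ContinuousOn f (Set.Ici a))
    (hne : ∀ t ≥ a, f t ≠ 0) (ha : 0 < f a) : ∀ t ≥ a, 0 < f t := by
  intro t ht
  by_contra! hle
  obtain ⟨s, hs, hs0⟩ := intermediate_value_Icc' ht (hf.mono Set.Icc_subset_Ici_self)
    ⟨hle, ha.le⟩
  exact hne s hs.1 hs0

/-- A function whose square is eventually dominated by a null function tends to zero. -/
theorem tendsto_zero_of_sq_le {α : Type*} {l : Filter α} {f g : α → ℝ}
    (hg : Tendsto g l (nhds 0)) (hle : ∀ᶠ t in l, f t ^ 2 ≤ g t) : Tendsto f l (nhds 0) := by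
  refine squeeze_zero_norm' (a := fun t => √(g t)) ?_ (by simpa using hg.sqrt)
  filter_upwards [hle] with t ht
  exact abs_le_sqrt ht

/-- Isotropization of LRS Bianchi II (Nil) solutions of topo-GR by a positive
cosmological constant: for a solution of the LRS Bianchi II topo-GR system on
`[t₀,∞)` with `Λ > 0`, `1 + 3w ≥ 0`, `ρ ≥ 0`, `r₂ > 0` and `H(t₀) > 0`, one
has `H(t) ≥ √(Λ/3)` for all `t ≥ t₀`, and as `t → ∞`: `H → √(Λ/3)`,
`σ₊ → 0`, `ρ → 0`, and `n₁·(r₂ − 1) → 0` (the spatial Ricci curvature is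
driven towards the reference Ricci curvature). -/
theorem topoGR_LRS_BianchiII_isotropization
    (κ Λ w t₀ : ℝ) (hκ : 0 < κ) (hΛ : 0 < Λ) (hw : 0 ≤ 1 + 3 * w)
    (H n₁ σp r₂ ρ : ℝ → ℝ)
    (hr₂pos : ∀ t ≥ t₀, 0 < r₂ t)
    (hHam : ∀ t ≥ t₀, (H t) ^ 2 = (σp t) ^ 2
      + (1 / 12) * (n₁ t) ^ 2 * (r₂ t - 1) ^ 2 + (κ * ρ t + Λ) / 3)
    (hRay : ∀ t ≥ t₀, HasDerivAt H
      (-(H t) ^ 2 - 2 * (σp t) ^ 2 - κ * (1 + 3 * w) * ρ t / 6 + Λ / 3) t)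
    (hn₁ : ∀ t ≥ t₀, HasDerivAt n₁ (-(n₁ t) * (H t + 4 * σp t)) t)
    (hσp : ∀ t ≥ t₀, HasDerivAt σp
      (-3 * H t * σp t - ((n₁ t) ^ 2 / 6) * (r₂ t + 2) * (r₂ t - 1)) t)
    (hr₂ : ∀ t ≥ t₀, HasDerivAt r₂ (6 * r₂ t * σp t) t)
    (hρ : ∀ t ≥ t₀, HasDerivAt ρ (-3 * (1 + w) * H t * ρ t) t)
    (hρnn : ∀ t ≥ t₀, 0 ≤ ρ t) (hH₀ : 0 < H t₀) :
    (∀ t ≥ t₀, Real.sqrt (Λ / 3) ≤ H t) ∧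
    Tendsto H atTop (nhds (Real.sqrt (Λ / 3))) ∧
    Tendsto σp atTop (nhds 0) ∧
    Tendsto ρ atTop (nhds 0) ∧
    Tendsto (fun t => n₁ t * (r₂ t - 1)) atTop (nhds 0) := by
  set h := √(Λ / 3)
  have hpos : 0 < h := sqrt_pos.2 (by positivity)
  have hsq : h ^ 2 = Λ / 3 := sq_sqrt (by positivity)
  have hHsq : ∀ t ≥ t₀, h ^ 2 ≤ H t ^ 2 := fun t ht => by
    have := mul_nonneg hκ.le (hρnn t ht)
    nlinarith [hHam t ht, sq_nonneg (σp t), sq_nonneg (n₁ t * (r₂ t - 1))]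
  have hHpos : ∀ t ≥ t₀, 0 < H t :=
    pos_of_continuousOn_of_ne_zero (fun t ht => (hRay t ht).continuousAt.continuousWithinAt)
      (fun t ht h0 => by nlinarith [hHsq t ht]) hH₀
  have hge : ∀ t ≥ t₀, h ≤ H t := fun t ht =>
    (sq_le_sq₀ hpos.le (hHpos t ht).le).1 (hHsq t ht)
  have hdecay := le_mul_exp_of_hasDerivAt_le (f := fun t => H t - h) (c := 2 * h)
    (fun t ht => (hRay t ht).sub_const h) (fun t ht => by
      have := mul_nonneg (mul_nonneg hκ.le hw) (hρnn t ht)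
      nlinarith [hge t ht, sq_nonneg (σp t), sq_nonneg (H t - h)])
  have hexp : Tendsto (fun t => (H t₀ - h) * exp (-(2 * h * (t - t₀)))) atTop (nhds 0) := by
    have hlin : Tendsto (fun t => 2 * h * (t - t₀)) atTop atTop :=
      (tendsto_atTop_add_const_right _ (-t₀) tendsto_id).const_mul_atTop (by positivity)
    simpa using (tendsto_exp_neg_atTop_nhds_zero.comp hlin).const_mul (H t₀ - h)
  have hsub : Tendsto (fun t => H t - h) atTop (nhds 0) := by
    refine squeeze_zero' ?_ ?_ hexp
    · filter_upwards [eventually_ge_atTop t₀] with t ht using sub_nonneg.2 (hge t ht)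
    · filter_upwards [eventually_ge_atTop t₀] with t ht using hdecay t ht
  have hH : Tendsto H atTop (nhds h) := by simpa using hsub.add_const h
  have hK : Tendsto (fun t => H t ^ 2 - h ^ 2) atTop (nhds 0) := by
    exact tendsto_sub_nhds_zero_iff.2 (hH.pow 2)
  refine ⟨hge, hH, tendsto_zero_of_sq_le hK ?_, ?_,
    tendsto_zero_of_sq_le (by simpa using hK.const_mul 12) ?_⟩
  · filter_upwards [eventually_ge_atTop t₀] with t ht
    have := mul_nonneg hκ.le (hρnn t ht)
    nlinarith [hHam t ht, sq_nonneg (n₁ t * (r₂ t - 1))]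
  · refine squeeze_zero' (g := fun t => 3 / κ * (H t ^ 2 - h ^ 2)) ?_ ?_
      (by simpa using hK.const_mul (3 / κ))
    · filter_upwards [eventually_ge_atTop t₀] with t ht using hρnn t ht
    · filter_upwards [eventually_ge_atTop t₀] with t ht
      rw [div_mul_eq_mul_div, le_div_iff₀ hκ]
      nlinarith [hHam t ht, sq_nonneg (σp t), sq_nonneg (n₁ t * (r₂ t - 1))]
  · filter_upwards [eventually_ge_atTop t₀] with t ht
    have := mul_nonneg hκ.le (hρnn t ht)
    nlinarith [hHam t ht, sq_nonneg (σp t)]
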